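/- arXiv:2306.05050 — 10 statements merged into one kernel-verified Lean document; each statement's English description precedes it below -/
import Mathlib

section
/- Let Γ=(P,L,I) be a rank-2 incidence geometry, λ ≥ 1, and suppose an orientation of a subset D of the edges of the multigraph I_λ(Γ) and a function peb : P ⊔ L → ℕ satisfy peb(p) + outdeg(p) = k₁ for every point p ∈ P and peb(ℓ) + outdeg(ℓ) = k₂ for every line ℓ ∈ L. If A ⊆ P and B ⊆ L are nonempty subsets such that, with W = A ∪ B, one has Σ_{v∈W} peb(v) + out(W) ≥ l, then span(W) ≤ k₁|A| + k₂|B| − l. -/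
open Finset

variable {α β : Type*} [DecidableEq α] [DecidableEq β]

/-- The source of the edge `e = ((p, ℓ), j)` of the multigraph `I_λ(Γ)` under the
orientation `σ`: the point `p` if `σ e = true`, and the line `ℓ` otherwise. -/
def src (σ : (α × β) × ℕ → Bool) (e : (α × β) × ℕ) : α ⊕ β :=
  if σ e then Sum.inl e.1.1 else Sum.inr e.1.2

/-- The target of the edge `e = ((p, ℓ), j)` under the orientation `σ`:
the endpoint which is not the source. -/
def tgt (σ : (α × β) × ℕ → Bool) (e : (α × β) × ℕ) : α ⊕ β :=
  if σ e then Sum.inr e.1.2 else Sum.inl e.1.1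

/-- The out-degree of a vertex `v`: the number of oriented edges of `D` with source `v`. -/
def outdeg (D : Finset ((α × β) × ℕ)) (σ : (α × β) × ℕ → Bool) (v : α ⊕ β) : ℕ :=
  (D.filter fun e => src σ e = v).card

/-- `span(W)`: the number of oriented edges of `D` with both source and target in `W`. -/
def spanE (D : Finset ((α × β) × ℕ)) (σ : (α × β) × ℕ → Bool)
    (W : Finset (α ⊕ β)) : ℕ :=
  (D.filter fun e => src σ e ∈ W ∧ tgt σ e ∈ W).card

/-- `out(W)`: the number of oriented edges of `D` with source in `W` and target outside `W`. -/
def outE (D : Finset ((α × β) × ℕ)) (σ : (α × β) × ℕ → Bool)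
    (W : Finset (α ⊕ β)) : ℕ :=
  (D.filter fun e => src σ e ∈ W ∧ tgt σ e ∉ W).card

/-- The out-degrees of the vertices of `W` sum to `span(W) + out(W)`. -/
theorem sum_outdeg_eq_spanE_add_outE (D : Finset ((α × β) × ℕ)) (σ : (α × β) × ℕ → Bool)
    (W : Finset (α ⊕ β)) :
    ∑ v ∈ W, outdeg D σ v = spanE D σ W + outE D σ W := by
  have h := Finset.card_eq_sum_card_fiberwise (s := D.filter fun e => src σ e ∈ W)
    (f := src σ) (t := W) (fun e he => (Finset.mem_filter.1 he).2)
  have hsplit := Finset.card_filter_add_card_filter_not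
    (s := D.filter fun e => src σ e ∈ W) (fun e => tgt σ e ∈ W)
  rw [Finset.filter_filter, Finset.filter_filter] at hsplit
  rw [spanE, outE, hsplit, h]
  refine Finset.sum_congr rfl fun v hv => ?_
  rw [outdeg, Finset.filter_filter]
  congr 1
  refine Finset.filter_congr fun e _ => ⟨fun he => ⟨he ▸ hv, he⟩, And.right⟩

/-- Invariant 4 of the pebble game: if `A ⊆ P`, `B ⊆ L` are nonempty and
`peb(W) + out(W) ≥ l` for `W = A ∪ B`, then `span(W) ≤ k₁|A| + k₂|B| - l`. -/
theorem span_le (lam k₁ k₂ l : ℕ) (hlam : 1 ≤ lam)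
    (P : Finset α) (L : Finset β) (I : Finset (α × β)) (hI : I ⊆ P ×ˢ L)
    (D : Finset ((α × β) × ℕ)) (hD : D ⊆ I ×ˢ Finset.range lam)
    (σ : (α × β) × ℕ → Bool) (peb : α ⊕ β → ℕ)
    (hpebP : ∀ p ∈ P, peb (Sum.inl p) + outdeg D σ (Sum.inl p) = k₁)
    (hpebL : ∀ x ∈ L, peb (Sum.inr x) + outdeg D σ (Sum.inr x) = k₂)
    (A : Finset α) (hA : A ⊆ P) (hAne : A.Nonempty)
    (B : Finset β) (hB : B ⊆ L) (hBne : B.Nonempty)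
    (hpeb : l ≤ (∑ v ∈ A.image Sum.inl ∪ B.image Sum.inr, peb v)
        + outE D σ (A.image Sum.inl ∪ B.image Sum.inr)) :
    (spanE D σ (A.image Sum.inl ∪ B.image Sum.inr) : ℤ)
      ≤ (k₁ : ℤ) * A.card + (k₂ : ℤ) * B.card - l := by
  have hsum : ∑ v ∈ A.image Sum.inl ∪ B.image Sum.inr, (peb v + outdeg D σ v)
      = k₁ * A.card + k₂ * B.card := by
    rw [Finset.sum_union (by simp [Finset.disjoint_left]),
      Finset.sum_image Sum.inl_injective.injOn, Finset.sum_image Sum.inr_injective.injOn,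
      Finset.sum_congr rfl fun p hp => hpebP p (hA hp),
      Finset.sum_congr rfl fun x hx => hpebL x (hB hx)]
    simp [mul_comm]
  rw [Finset.sum_add_distrib, sum_outdeg_eq_spanE_add_outE] at hsum
  zify at hsum hpeb
  linarith
end

section
/- Let Γ=(P,L,I) be a (λ,k₁,k₂,l)-sparse rank-2 incidence geometry and let J₁, J₂ ⊆ I be blocks such that P(J₁) ∩ P(J₂) ≠ ∅ and L(J₁) ∩ L(J₂) ≠ ∅. Then the induced set I_∪ := I ∩ ((P(J₁) ∪ P(J₂)) × (L(J₁) ∪ L(J₂))) satisfies λ|I_∪| = k₁|P(J₁) ∪ P(J₂)| + k₂|L(J₁) ∪ L(J₂)| − l; in particular I_∪ is a block. -/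
open Finset

variable {α β : Type*} [DecidableEq α] [DecidableEq β]

/-- A rank-2 incidence geometry with incidence set `I` is `(lam, k₁, k₂, l)`-sparse if
every nonempty subset `I'` of `I` satisfies
`lam * |I'| ≤ k₁ * |P(I')| + k₂ * |L(I')| - l`, where `P(I') × L(I')` is the support. -/
def IsSparse (lam k₁ k₂ l : ℕ) (I : Finset (α × β)) : Prop :=
  ∀ I' ⊆ I, I'.Nonempty →
    (lam : ℤ) * I'.card ≤
      (k₁ : ℤ) * (I'.image Prod.fst).card + (k₂ : ℤ) * (I'.image Prod.snd).card - l

/-- A block of a rank-2 incidence geometry with incidence set `I` is a nonempty subset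
`J ⊆ I` with `lam * |J| = k₁ * |P(J)| + k₂ * |L(J)| - l`. -/
def IsBlock (lam k₁ k₂ l : ℕ) (I J : Finset (α × β)) : Prop :=
  J ⊆ I ∧ J.Nonempty ∧
    (lam : ℤ) * J.card =
      (k₁ : ℤ) * (J.image Prod.fst).card + (k₂ : ℤ) * (J.image Prod.snd).card - l

/-- Sparsity applied to a single incidence gives `lam + l ≤ k₁ + k₂`. -/
lemma IsSparse.add_le_of_mem {lam k₁ k₂ l : ℕ} {I : Finset (α × β)}
    (h : IsSparse lam k₁ k₂ l I) {x : α × β} (hx : x ∈ I) :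
    (lam : ℤ) + l ≤ k₁ + k₂ := by
  have := h {x} (singleton_subset_iff.2 hx) (singleton_nonempty x)
  simp only [card_singleton, image_singleton, Nat.cast_one, mul_one] at this
  linarith

/-- The sparsity bound for `J`, with the support of `J` enlarged to nonempty sets `P`, `L`; here
`J` may be empty. -/
lemma IsSparse.mul_card_le {lam k₁ k₂ l : ℕ} {I J : Finset (α × β)}
    (h : IsSparse lam k₁ k₂ l I) (hI : I.Nonempty) (hJ : J ⊆ I) {P : Finset α} {L : Finset β}
    (hP : P.Nonempty) (hL : L.Nonempty) (hJP : J.image Prod.fst ⊆ P)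
    (hJL : J.image Prod.snd ⊆ L) :
    (lam : ℤ) * J.card ≤ k₁ * P.card + k₂ * L.card - l := by
  rcases J.eq_empty_or_nonempty with rfl | hne
  · obtain ⟨x, hx⟩ := hI
    have hl := h.add_le_of_mem hx
    have hP' : (k₁ : ℤ) ≤ k₁ * P.card := by exact_mod_cast Nat.le_mul_of_pos_right k₁ hP.card_pos
    have hL' : (k₂ : ℤ) ≤ k₂ * L.card := by exact_mod_cast Nat.le_mul_of_pos_right k₂ hL.card_pos
    simp only [card_empty, Nat.cast_zero, mul_zero]
    linarith [Int.natCast_nonneg lam]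
  · refine (h J hJ hne).trans ?_
    gcongr

/-- The union of two blocks whose point supports and line supports both intersect is a block. -/
theorem block_union (lam k₁ k₂ l : ℕ)
    (I : Finset (α × β)) (hsparse : IsSparse lam k₁ k₂ l I)
    (J₁ J₂ : Finset (α × β))
    (h₁ : IsBlock lam k₁ k₂ l I J₁) (h₂ : IsBlock lam k₁ k₂ l I J₂)
    (hP : ((J₁.image Prod.fst) ∩ (J₂.image Prod.fst)).Nonempty)
    (hL : ((J₁.image Prod.snd) ∩ (J₂.image Prod.snd)).Nonempty) :
    (lam : ℤ) * (I ∩ ((J₁.image Prod.fst ∪ J₂.image Prod.fst) ×ˢ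
        (J₁.image Prod.snd ∪ J₂.image Prod.snd))).card =
      (k₁ : ℤ) * (J₁.image Prod.fst ∪ J₂.image Prod.fst).card
        + (k₂ : ℤ) * (J₁.image Prod.snd ∪ J₂.image Prod.snd).card - l ∧
    IsBlock lam k₁ k₂ l I (I ∩ ((J₁.image Prod.fst ∪ J₂.image Prod.fst) ×ˢ
        (J₁.image Prod.snd ∪ J₂.image Prod.snd))) := by
  obtain ⟨hJ₁, hne, e₁⟩ := h₁
  obtain ⟨hJ₂, -, e₂⟩ := h₂
  set P₁ := J₁.image Prod.fst with hP₁
  set P₂ := J₂.image Prod.fst with hP₂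
  set L₁ := J₁.image Prod.snd with hL₁
  set L₂ := J₂.image Prod.snd with hL₂
  set K := I ∩ ((P₁ ∪ P₂) ×ˢ (L₁ ∪ L₂)) with hK
  have hsub : J₁ ∪ J₂ ⊆ K := by
    refine subset_inter (union_subset hJ₁ hJ₂) ?_
    refine subset_product.trans (product_subset_product ?_ ?_) <;> rw [image_union]
  have hKI : K ⊆ I := inter_subset_left
  have hKne : K.Nonempty := (hne.mono subset_union_left).mono hsub
  have hKP : K.image Prod.fst = P₁ ∪ P₂ := by
    refine Subset.antisymm (image_subset_iff.2 fun x hx ↦ ?_) ?_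
    · exact (mem_product.1 (mem_inter.1 hx).2).1
    · rw [hP₁, hP₂, ← image_union]
      exact image_subset_image hsub
  have hKL : K.image Prod.snd = L₁ ∪ L₂ := by
    refine Subset.antisymm (image_subset_iff.2 fun x hx ↦ ?_) ?_
    · exact (mem_product.1 (mem_inter.1 hx).2).2
    · rw [hL₁, hL₂, ← image_union]
      exact image_subset_image hsub
  have hcard : (lam : ℤ) * K.card =
      (k₁ : ℤ) * (P₁ ∪ P₂).card + (k₂ : ℤ) * (L₁ ∪ L₂).card - l := by
    have upper := hsparse K hKI hKne
    rw [hKP, hKL] at upper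
    have hinter := hsparse.mul_card_le (hne.mono hJ₁) (inter_subset_left.trans hJ₁) hP hL
      (image_inter_subset Prod.fst J₁ J₂) (image_inter_subset Prod.snd J₁ J₂)
    have hunion : (lam : ℤ) * (J₁ ∪ J₂).card ≤ lam * K.card := by gcongr
    have cJ : ((J₁ ∪ J₂).card : ℤ) + (J₁ ∩ J₂).card = J₁.card + J₂.card := by
      exact_mod_cast card_union_add_card_inter J₁ J₂
    have cP : ((P₁ ∪ P₂).card : ℤ) + (P₁ ∩ P₂).card = P₁.card + P₂.card := by
      exact_mod_cast card_union_add_card_inter P₁ P₂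
    have cL : ((L₁ ∪ L₂).card : ℤ) + (L₁ ∩ L₂).card = L₁.card + L₂.card := by
      exact_mod_cast card_union_add_card_inter L₁ L₂
    refine upper.antisymm ?_
    linear_combination hunion + hinter - e₁ - e₂ - lam * cJ + k₁ * cP + k₂ * cL
  exact ⟨hcard, hKI, hKne, by rw [hKP, hKL]; exact hcard⟩
end

section
/- Let Γ=(P,L,I) be a (λ,k₁,k₂,l)-sparse rank-2 incidence geometry with λ ≥ 1 and k₁, k₂ ≥ 1, and fix p ∈ P and ℓ ∈ L. Suppose the family 𝓑 of all blocks J ⊆ I with p ∈ P(J) and ℓ ∈ L(J) is nonempty. Then M := ⋂_{J∈𝓑} J is a block of Γ with P(M) = ⋂_{J∈𝓑} P(J) and L(M) = ⋂_{J∈𝓑} L(J); in particular p ∈ P(M) and ℓ ∈ L(M). -/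
open Finset

variable {α β : Type*} [DecidableEq α] [DecidableEq β]

/-- Two blocks of a sparse geometry whose supports share a point and a line intersect in a block,
and the support of the intersection is the intersection of the supports. -/
theorem IsBlock.inter {lam k₁ k₂ l : ℕ} (hlam : 1 ≤ lam) (hk₁ : 1 ≤ k₁) (hk₂ : 1 ≤ k₂)
    {I A B : Finset (α × β)} (hsparse : IsSparse lam k₁ k₂ l I)
    (hA : IsBlock lam k₁ k₂ l I A) (hB : IsBlock lam k₁ k₂ l I B)
    (hP : (A.image Prod.fst ∩ B.image Prod.fst).Nonempty)
    (hL : (A.image Prod.snd ∩ B.image Prod.snd).Nonempty) :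
    IsBlock lam k₁ k₂ l I (A ∩ B) ∧
      (A ∩ B).image Prod.fst = A.image Prod.fst ∩ B.image Prod.fst ∧
      (A ∩ B).image Prod.snd = A.image Prod.snd ∩ B.image Prod.snd := by
  obtain ⟨hAI, hAne, hAeq⟩ := hA
  obtain ⟨hBI, hBne, hBeq⟩ := hB
  have hunion := hsparse (A ∪ B) (union_subset hAI hBI) (hAne.mono subset_union_left)
  rw [image_union, image_union] at hunion
  have hcard : ((A ∪ B).card : ℤ) + (A ∩ B).card = A.card + B.card := by
    exact_mod_cast card_union_add_card_inter A B
  have hcardP := card_union_add_card_inter (A.image Prod.fst) (B.image Prod.fst)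
  have hcardL := card_union_add_card_inter (A.image Prod.snd) (B.image Prod.snd)
  zify at hcardP hcardL
  have hupper : (k₁ : ℤ) * (A.image Prod.fst ∩ B.image Prod.fst).card +
      k₂ * (A.image Prod.snd ∩ B.image Prod.snd).card - l ≤ lam * (A ∩ B).card := by
    linear_combination hunion - hAeq - hBeq - (lam : ℤ) * hcard +
      (k₁ : ℤ) * hcardP + (k₂ : ℤ) * hcardL
  have hk₁' : (1 : ℤ) ≤ k₁ := by exact_mod_cast hk₁
  have hk₂' : (1 : ℤ) ≤ k₂ := by exact_mod_cast hk₂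
  have hne : (A ∩ B).Nonempty := by
    by_contra hempty
    rw [not_nonempty_iff_eq_empty] at hempty
    obtain ⟨e, he⟩ := hAne
    have hsingle := hsparse {e} (singleton_subset_iff.2 (hAI he)) (singleton_nonempty e)
    simp only [image_singleton, card_singleton, Nat.cast_one, mul_one] at hsingle
    simp only [hempty, card_empty, Nat.cast_zero, mul_zero] at hupper
    have hP' : (1 : ℤ) ≤ (A.image Prod.fst ∩ B.image Prod.fst).card := by
      exact_mod_cast hP.card_pos
    have hL' : (1 : ℤ) ≤ (A.image Prod.snd ∩ B.image Prod.snd).card := by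
      exact_mod_cast hL.card_pos
    have hlam' : (1 : ℤ) ≤ lam := by exact_mod_cast hlam
    nlinarith
  have hlower := hsparse (A ∩ B) (inter_subset_left.trans hAI) hne
  have hsubP := image_inter_subset Prod.fst A B
  have hsubL := image_inter_subset Prod.snd A B
  have hleP : (((A ∩ B).image Prod.fst).card : ℤ) ≤
      (A.image Prod.fst ∩ B.image Prod.fst).card := by exact_mod_cast card_le_card hsubP
  have hleL : (((A ∩ B).image Prod.snd).card : ℤ) ≤
      (A.image Prod.snd ∩ B.image Prod.snd).card := by exact_mod_cast card_le_card hsubL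
  have heqP : (A ∩ B).image Prod.fst = A.image Prod.fst ∩ B.image Prod.fst := by
    refine eq_of_subset_of_card_le hsubP ?_
    zify
    nlinarith
  have heqL : (A ∩ B).image Prod.snd = A.image Prod.snd ∩ B.image Prod.snd := by
    refine eq_of_subset_of_card_le hsubL ?_
    zify
    nlinarith
  refine ⟨⟨inter_subset_left.trans hAI, hne, le_antisymm hlower ?_⟩, heqP, heqL⟩
  rw [heqP, heqL]
  exact hupper

/-- A nonempty finite family of blocks whose supports all contain a given point and line
intersects in a block, and the support of the intersection is the intersection of the supports. -/
theorem IsBlock.finset_inf' {lam k₁ k₂ l : ℕ} (hlam : 1 ≤ lam) (hk₁ : 1 ≤ k₁) (hk₂ : 1 ≤ k₂)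
    {I : Finset (α × β)} (hsparse : IsSparse lam k₁ k₂ l I) {p : α} {x : β}
    {S : Finset (Finset (α × β))} (hS : S.Nonempty)
    (hblock : ∀ J ∈ S, IsBlock lam k₁ k₂ l I J ∧ p ∈ J.image Prod.fst ∧ x ∈ J.image Prod.snd) :
    IsBlock lam k₁ k₂ l I (S.inf' hS id) ∧
    (S.inf' hS id).image Prod.fst = S.inf' hS (fun J => J.image Prod.fst) ∧
    (S.inf' hS id).image Prod.snd = S.inf' hS (fun J => J.image Prod.snd) ∧
    p ∈ (S.inf' hS id).image Prod.fst ∧ x ∈ (S.inf' hS id).image Prod.snd := by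
  induction hS using Finset.Nonempty.cons_induction with
  | singleton J =>
    obtain ⟨hJ, hp, hx⟩ := hblock J (mem_singleton_self J)
    exact ⟨hJ, rfl, rfl, hp, hx⟩
  | cons J T hJT hT ih =>
    obtain ⟨hJ, hpJ, hxJ⟩ := hblock J (mem_cons_self J T)
    obtain ⟨hM, hMP, hML, hpM, hxM⟩ := ih fun K hK => hblock K (mem_cons_of_mem hK)
    have hp := mem_inter.2 ⟨hpJ, hpM⟩
    have hx := mem_inter.2 ⟨hxJ, hxM⟩
    obtain ⟨hinter, hP, hL⟩ := hJ.inter hlam hk₁ hk₂ hsparse hM ⟨p, hp⟩ ⟨x, hx⟩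
    rw [inf'_cons hT, inf'_cons hT, inf'_cons hT, ← hMP, ← hML]
    exact ⟨hinter, hP, hL, hP.symm ▸ hp, hL.symm ▸ hx⟩

open scoped Classical in
/-- If the family `𝓑` of blocks whose supports contain a given point `p` and line `x` is
nonempty, then its intersection `M` is a block whose supports are the intersections of the
supports; in particular `p ∈ P(M)` and `x ∈ L(M)`. -/
theorem block_inf (lam k₁ k₂ l : ℕ) (hlam : 1 ≤ lam) (hk₁ : 1 ≤ k₁) (hk₂ : 1 ≤ k₂)
    (P : Finset α) (L : Finset β) (I : Finset (α × β)) (hI : I ⊆ P ×ˢ L)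
    (hsparse : IsSparse lam k₁ k₂ l I)
    (p : α) (x : β) (hp : p ∈ P) (hx : x ∈ L)
    (𝓑 : Finset (Finset (α × β)))
    (h𝓑 : 𝓑 = I.powerset.filter fun J =>
        IsBlock lam k₁ k₂ l I J ∧ p ∈ J.image Prod.fst ∧ x ∈ J.image Prod.snd)
    (h𝓑ne : 𝓑.Nonempty) :
    IsBlock lam k₁ k₂ l I (𝓑.inf' h𝓑ne id) ∧
    (𝓑.inf' h𝓑ne id).image Prod.fst = 𝓑.inf' h𝓑ne (fun J => J.image Prod.fst) ∧
    (𝓑.inf' h𝓑ne id).image Prod.snd = 𝓑.inf' h𝓑ne (fun J => J.image Prod.snd) ∧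
    p ∈ (𝓑.inf' h𝓑ne id).image Prod.fst ∧ x ∈ (𝓑.inf' h𝓑ne id).image Prod.snd := by
  subst h𝓑
  exact IsBlock.finset_inf' hlam hk₁ hk₂ hsparse h𝓑ne fun J hJ => (mem_filter.1 hJ).2
end

section
/- Let k₁, k₂ ≥ 1 and l be natural numbers with l ≤ k₁ + k₂ − 1, and let n ≥ k₂ and m ≥ k₁ be integers with nm ≥ k₁n + k₂m − l. Then there exist integers a₀ and b₀ with k₂ ≤ a₀ ≤ n and k₁ ≤ b₀ ≤ m, and a (1,k₁,k₂,l)-tight rank-2 incidence geometry Γ=(P,L,I) with |P| = a₀ points and |L| = b₀ lines. -/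
open Finset

variable {α β : Type*} [DecidableEq α] [DecidableEq β]

/-- A rank-2 incidence geometry `Γ = (P, L, I)` is `(lam, k₁, k₂, l)`-tight if it is sparse and
`lam * |I| = k₁ * |P| + k₂ * |L| - l`. -/
def IsTight (lam k₁ k₂ l : ℕ) (P : Finset α) (L : Finset β) (I : Finset (α × β)) : Prop :=
  I ⊆ P ×ˢ L ∧ IsSparse lam k₁ k₂ l I ∧
    (lam : ℤ) * I.card = (k₁ : ℤ) * P.card + (k₂ : ℤ) * L.card - l

/-- If no proper subgrid of an `a × b` grid with at least `k₂` points and `k₁` lines reaches the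
tight incidence count, then every nonempty proper subgrid satisfies the sparsity bound. -/
lemma mul_le_of_minimal {k₁ k₂ l a b : ℕ} (hl : (l : ℤ) ≤ (k₁ : ℤ) + (k₂ : ℤ) - 1)
    (hk : (l : ℤ) ≤ (k₁ : ℤ) * k₂)
    (hmin : ∀ c d : ℕ, k₂ ≤ c → c ≤ a → k₁ ≤ d → d ≤ b →
      (k₁ : ℤ) * c + (k₂ : ℤ) * d - l ≤ (c : ℤ) * d → c = a ∧ d = b)
    {c d : ℕ} (hc : 1 ≤ c) (hca : c ≤ a) (hd : 1 ≤ d) (hdb : d ≤ b)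
    (hne : ¬ (c = a ∧ d = b)) :
    (c : ℤ) * d ≤ (k₁ : ℤ) * c + (k₂ : ℤ) * d - l := by
  by_cases h₂ : k₂ ≤ c <;> by_cases h₁ : k₁ ≤ d
  · by_contra! h
    exact hne (hmin c d h₂ hca h₁ hdb h.le)
  · have := mul_nonneg (a := (c : ℤ) - k₂) (b := (k₁ : ℤ) - d) (by lia) (by lia)
    linarith
  · have := mul_nonneg (a := (k₂ : ℤ) - c) (b := (d : ℤ) - k₁) (by lia) (by lia)
    linarith
  · have h₃ := mul_le_mul (a := (k₂ : ℤ) - c) (b := (k₂ : ℤ) - 1) (c := (k₁ : ℤ) - d)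
      (d := (k₁ : ℤ) - 1) (by lia) (by lia) (by lia) (by lia)
    linarith

/-- For `l ≤ k₁ + k₂ - 1` and `n ≥ k₂`, `m ≥ k₁` with `n * m ≥ k₁ * n + k₂ * m - l`,
there exist `a₀, b₀` with `k₂ ≤ a₀ ≤ n` and `k₁ ≤ b₀ ≤ m` and a `(1, k₁, k₂, l)`-tight
incidence geometry with `a₀` points and `b₀` lines. -/
theorem exists_tight (k₁ k₂ l : ℕ) (hk₁ : 1 ≤ k₁) (hk₂ : 1 ≤ k₂)
    (hl : (l : ℤ) ≤ (k₁ : ℤ) + (k₂ : ℤ) - 1)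
    (n m : ℕ) (hn : k₂ ≤ n) (hm : k₁ ≤ m)
    (hnm : (k₁ : ℤ) * n + (k₂ : ℤ) * m - l ≤ (n : ℤ) * m) :
    ∃ a₀ b₀ : ℕ, k₂ ≤ a₀ ∧ a₀ ≤ n ∧ k₁ ≤ b₀ ∧ b₀ ≤ m ∧
      ∃ I : Finset (ℕ × ℕ),
        IsTight 1 k₁ k₂ l (Finset.range a₀) (Finset.range b₀) I := by
  classical
  have hk : (l : ℤ) ≤ (k₁ : ℤ) * k₂ := by
    have := mul_nonneg (a := (k₁ : ℤ) - 1) (b := (k₂ : ℤ) - 1) (by lia) (by lia)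
    linarith
  have hex : ∃ s a b : ℕ, a + b = s ∧ k₂ ≤ a ∧ a ≤ n ∧ k₁ ≤ b ∧ b ≤ m ∧
      (k₁ : ℤ) * a + (k₂ : ℤ) * b - l ≤ (a : ℤ) * b :=
    ⟨_, n, m, rfl, hn, le_rfl, hm, le_rfl, hnm⟩
  obtain ⟨a, b, hs, ha, han, hb, hbm, hab⟩ := Nat.find_spec hex
  have hmin : ∀ c d : ℕ, k₂ ≤ c → c ≤ a → k₁ ≤ d → d ≤ b →
      (k₁ : ℤ) * c + (k₂ : ℤ) * d - l ≤ (c : ℤ) * d → c = a ∧ d = b := by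
    intro c d hc hca hd hdb h
    have := Nat.find_min' hex
      ⟨c, d, rfl, hc, hca.trans han, hd, hdb.trans hbm, h⟩
    lia
  refine ⟨a, b, ha, han, hb, hbm, ?_⟩
  have hpos : 0 ≤ (k₁ : ℤ) * a + (k₂ : ℤ) * b - l := by
    have h₁ := mul_le_mul_of_nonneg_left (a := (k₁ : ℤ)) (b := 1) (c := a) (by lia) (by lia)
    have h₂ := mul_le_mul_of_nonneg_left (a := (k₂ : ℤ)) (b := 1) (c := b) (by lia) (by lia)
    linarith
  obtain ⟨t, ht⟩ := Int.eq_ofNat_of_zero_le hpos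
  obtain ⟨I, hI, hcard⟩ := Finset.exists_subset_card_eq
    (s := Finset.range a ×ˢ Finset.range b) (n := t) (by
      rw [Finset.card_product, Finset.card_range, Finset.card_range]
      rw [ht] at hab
      exact_mod_cast hab)
  refine ⟨I, hI, fun J hJ hJne => ?_, by simp [hcard, ht]⟩
  have hfst : J.image Prod.fst ⊆ Finset.range a := by
    intro x hx
    obtain ⟨p, hp, rfl⟩ := Finset.mem_image.1 hx
    exact (Finset.mem_product.1 (hI (hJ hp))).1
  have hsnd : J.image Prod.snd ⊆ Finset.range b := by
    intro x hx
    obtain ⟨p, hp, rfl⟩ := Finset.mem_image.1 hx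
    exact (Finset.mem_product.1 (hI (hJ hp))).2
  have hca := Finset.card_le_card hfst
  have hdb := Finset.card_le_card hsnd
  rw [Finset.card_range] at hca hdb
  rw [Nat.cast_one, one_mul]
  by_cases hfull : (J.image Prod.fst).card = a ∧ (J.image Prod.snd).card = b
  · rw [hfull.1, hfull.2, ht]
    exact_mod_cast (Finset.card_le_card hJ).trans_eq hcard
  · have hJle : J.card ≤ (J.image Prod.fst).card * (J.image Prod.snd).card := by
      rw [← Finset.card_product]
      exact Finset.card_le_card Finset.subset_product
    refine le_trans (by exact_mod_cast hJle) (mul_le_of_minimal hl hk hmin ?_ hca ?_ hdb hfull)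
    · exact (hJne.image _).card_pos
    · exact (hJne.image _).card_pos
end

section
/- Let k₁, k₂, l be natural numbers and let a₀, b₀ be positive integers such that a₀b₀ ≥ k₁a₀ + k₂b₀ − l and such that for all positive integers a ≤ a₀ and b ≤ b₀ with a + b < a₀ + b₀ one has ab ≤ k₁a + k₂b − l. Then for any finite sets P, L with |P| = a₀ and |L| = b₀, every subset I ⊆ P×L with |I| = k₁a₀ + k₂b₀ − l makes (P,L,I) a (1,k₁,k₂,l)-tight rank-2 incidence geometry. -/
open Finset

variable {α β : Type*} [DecidableEq α] [DecidableEq β]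

/-- If `a₀, b₀` are positive with `a₀ * b₀ ≥ k₁ * a₀ + k₂ * b₀ - l`, and
`a * b ≤ k₁ * a + k₂ * b - l` for all positive `a ≤ a₀`, `b ≤ b₀` with `a + b < a₀ + b₀`,
then any incidence set of size exactly `k₁ * a₀ + k₂ * b₀ - l` between `a₀` points and `b₀`
lines gives a `(1, k₁, k₂, l)`-tight geometry. -/
theorem tight_of_minimal_counts (k₁ k₂ l : ℕ) (a₀ b₀ : ℕ) (ha₀ : 1 ≤ a₀) (hb₀ : 1 ≤ b₀)
    (hbig : (k₁ : ℤ) * a₀ + (k₂ : ℤ) * b₀ - l ≤ (a₀ : ℤ) * b₀)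
    (hmin : ∀ a b : ℕ, 1 ≤ a → 1 ≤ b → a ≤ a₀ → b ≤ b₀ → a + b < a₀ + b₀ →
      (a : ℤ) * b ≤ (k₁ : ℤ) * a + (k₂ : ℤ) * b - l)
    (P : Finset α) (L : Finset β) (hP : P.card = a₀) (hL : L.card = b₀)
    (I : Finset (α × β)) (hI : I ⊆ P ×ˢ L)
    (hIcard : (I.card : ℤ) = (k₁ : ℤ) * a₀ + (k₂ : ℤ) * b₀ - l) :
    IsTight 1 k₁ k₂ l P L I := by
  refine ⟨hI, fun I' hI' hne => ?_, by rw [hP, hL, ← hIcard]; simp⟩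
  have hfst : I'.image Prod.fst ⊆ P := image_subset_iff.2 fun x hx =>
    (mem_product.1 (hI (hI' hx))).1
  have hsnd : I'.image Prod.snd ⊆ L := image_subset_iff.2 fun x hx =>
    (mem_product.1 (hI (hI' hx))).2
  have hsub : I' ⊆ I'.image Prod.fst ×ˢ I'.image Prod.snd := subset_product
  have hcard := card_le_card hsub
  rw [card_product] at hcard
  have ha := card_le_card hfst
  have hb := card_le_card hsnd
  have ha_pos := (hne.image Prod.fst).card_pos
  have hb_pos := (hne.image Prod.snd).card_pos
  rw [hP] at ha
  rw [hL] at hb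
  rw [Nat.cast_one, one_mul]
  by_cases hlt : (I'.image Prod.fst).card + (I'.image Prod.snd).card < a₀ + b₀
  · exact le_trans (by exact_mod_cast hcard) (hmin _ _ ha_pos hb_pos ha hb hlt)
  · have ha_eq : (I'.image Prod.fst).card = a₀ := by omega
    have hb_eq : (I'.image Prod.snd).card = b₀ := by omega
    rw [ha_eq, hb_eq, ← hIcard]
    exact_mod_cast card_le_card hI'
end

section
/- Let k₁, k₂ ≥ 1 and l be natural numbers with l ≤ k₁ + k₂ − 1, and let Γ=(P,L,I) be a (1,k₁,k₂,l)-tight rank-2 incidence geometry. Let p ∉ P be a new point and L' ⊆ L a set of lines with |L'| = k₁. Then the geometry (P ∪ {p}, L, I ∪ ({p} × L')) is (1,k₁,k₂,l)-tight. -/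
open Finset

variable {α β : Type*} [DecidableEq α] [DecidableEq β]

/-- If at most `k₁` incidences of `I'` involve `p` and the incidences off `p` form a
sparse set, then the count of `I'` obeys the sparsity bound. -/
theorem card_le_of_sparse_away_from_point {k₁ k₂ l : ℕ} (hk₂ : 1 ≤ k₂)
    (hl : (l : ℤ) ≤ (k₁ : ℤ) + (k₂ : ℤ) - 1) (p : α) {I' : Finset (α × β)} (hne : I'.Nonempty)
    (hsparse : IsSparse 1 k₁ k₂ l (I'.filter (fun x => x.1 ≠ p)))
    (hdeg : (I'.filter (fun x => x.1 = p)).card ≤ k₁) :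
    ((1 : ℕ) : ℤ) * I'.card ≤
      (k₁ : ℤ) * (I'.image Prod.fst).card + (k₂ : ℤ) * (I'.image Prod.snd).card - l := by
  have hcard := card_filter_add_card_filter_not (s := I') (fun x => x.1 = p)
  set A := I'.filter (fun x => x.1 ≠ p) with hA
  set B := I'.filter (fun x => x.1 = p) with hB
  have hcard' : (I'.card : ℤ) = B.card + A.card := by exact_mod_cast hcard.symm
  rcases B.eq_empty_or_nonempty with hBe | hBne
  · have hAI : A = I' := by
      rw [hA, filter_eq_self]
      exact fun x hx hxp => notMem_empty x (hBe ▸ mem_filter.2 ⟨hx, hxp⟩)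
    rw [hAI] at hsparse
    exact hsparse I' subset_rfl hne
  have hpI : p ∈ I'.image Prod.fst := by
    obtain ⟨x, hx⟩ := hBne
    exact mem_image.2 ⟨x, (mem_filter.1 hx).1, (mem_filter.1 hx).2⟩
  have hdeg' : (B.card : ℤ) ≤ k₁ := by exact_mod_cast hdeg
  rcases A.eq_empty_or_nonempty with hAe | hAne
  · have hinj : (B.image Prod.snd).card = B.card := by
      refine card_image_of_injOn fun x hx y hy hxy => Prod.ext ?_ hxy
      exact (mem_filter.1 hx).2.trans (mem_filter.1 hy).2.symm
    have hlines : (B.card : ℤ) ≤ (I'.image Prod.snd).card := by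
      rw [← hinj]
      exact_mod_cast card_le_card (image_subset_image (filter_subset _ _))
    have hpoints : (1 : ℤ) ≤ (I'.image Prod.fst).card := by
      exact_mod_cast card_pos.2 ⟨p, hpI⟩
    have hBpos : (1 : ℤ) ≤ B.card := by exact_mod_cast hBne.card_pos
    have hA0 : (A.card : ℤ) = 0 := by simp [hAe]
    have hk₂' : (1 : ℤ) ≤ k₂ := by exact_mod_cast hk₂
    push_cast
    nlinarith [mul_le_mul_of_nonneg_left hpoints (Int.natCast_nonneg k₁),
      mul_le_mul_of_nonneg_left hlines (Int.natCast_nonneg k₂),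
      mul_nonneg (sub_nonneg.2 hk₂') (sub_nonneg.2 hBpos)]
  · have hpA : p ∉ A.image Prod.fst := by simp [hA]
    have hpoints : ((A.image Prod.fst).card : ℤ) + 1 ≤ (I'.image Prod.fst).card := by
      have := card_le_card (insert_subset hpI
        (image_subset_image (f := Prod.fst) (filter_subset _ _ : A ⊆ I')))
      rw [card_insert_of_notMem hpA] at this
      exact_mod_cast this
    have hlines : ((A.image Prod.snd).card : ℤ) ≤ (I'.image Prod.snd).card := by
      exact_mod_cast card_le_card (image_subset_image (filter_subset _ _))
    have hbound := hsparse A subset_rfl hAne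
    push_cast at hbound ⊢
    nlinarith [mul_le_mul_of_nonneg_left hpoints (Int.natCast_nonneg k₁),
      mul_le_mul_of_nonneg_left hlines (Int.natCast_nonneg k₂)]

/-- Adding a new point incident to `k₁` existing lines preserves `(1, k₁, k₂, l)`-tightness. -/
theorem tight_add_point (k₁ k₂ l : ℕ) (hk₁ : 1 ≤ k₁) (hk₂ : 1 ≤ k₂)
    (hl : (l : ℤ) ≤ (k₁ : ℤ) + (k₂ : ℤ) - 1)
    (P : Finset α) (L : Finset β) (I : Finset (α × β))
    (htight : IsTight 1 k₁ k₂ l P L I)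
    (p : α) (hp : p ∉ P) (L' : Finset β) (hL' : L' ⊆ L) (hL'card : L'.card = k₁) :
    IsTight 1 k₁ k₂ l (insert p P) L (I ∪ ({p} ×ˢ L')) := by
  obtain ⟨hI, hsparse, hcount⟩ := htight
  have hpI : ∀ x ∈ I, x.1 ≠ p := fun x hx hxp => hp (hxp ▸ (mem_product.1 (hI hx)).1)
  refine ⟨union_subset (hI.trans (product_subset_product_left (subset_insert p P)))
    (product_subset_product (by simp) hL'), fun I' hI' hne => ?_, ?_⟩
  · refine card_le_of_sparse_away_from_point hk₂ hl p hne (fun J hJ => hsparse J ?_) ?_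
    · intro x hx
      obtain ⟨hxI', hxp⟩ := mem_filter.1 (hJ hx)
      refine (mem_union.1 (hI' hxI')).resolve_right fun h => hxp ?_
      exact mem_singleton.1 (mem_product.1 h).1
    · have hsub : I'.filter (fun x => x.1 = p) ⊆ {p} ×ˢ L' := by
        intro x hx
        obtain ⟨hxI', hxp⟩ := mem_filter.1 hx
        exact (mem_union.1 (hI' hxI')).resolve_left fun h => hpI x h hxp
      simpa [hL'card] using card_le_card hsub
  · have hdisj : Disjoint I ({p} ×ˢ L') := disjoint_left.2 fun x hx h =>
      hpI x hx (mem_singleton.1 (mem_product.1 h).1)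
    rw [card_union_of_disjoint hdisj, card_insert_of_notMem hp, card_product, card_singleton,
      hL'card]
    push_cast at hcount ⊢
    linarith
end

section
/- Let k₁, k₂ ≥ 1 and l be natural numbers with l ≤ k₁ + k₂ − 1, and let Γ=(P,L,I) be a (1,k₁,k₂,l)-tight rank-2 incidence geometry. Let e ∉ L be a new line and P' ⊆ P a set of points with |P'| = k₂. Then the geometry (P, L ∪ {e}, I ∪ (P' × {e})) is (1,k₁,k₂,l)-tight. -/
open Finset

variable {α β : Type*} [DecidableEq α] [DecidableEq β]

/-- A set of incidences with a single line has as many points as incidences. -/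
theorem card_image_fst_of_snd_eq {γ δ : Type*} [DecidableEq γ] {B : Finset (γ × δ)} {e : δ}
    (h : ∀ x ∈ B, x.2 = e) :
    (B.image Prod.fst).card = B.card :=
  card_image_of_injOn fun x hx y hy hxy => Prod.ext hxy ((h x hx).trans (h y hy).symm)

/-- Adding a new line incident to `k₂` existing points preserves `(1, k₁, k₂, l)`-tightness. -/
theorem tight_add_line (k₁ k₂ l : ℕ) (hk₁ : 1 ≤ k₁) (hk₂ : 1 ≤ k₂)
    (hl : (l : ℤ) ≤ (k₁ : ℤ) + (k₂ : ℤ) - 1)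
    (P : Finset α) (L : Finset β) (I : Finset (α × β))
    (htight : IsTight 1 k₁ k₂ l P L I)
    (e : β) (he : e ∉ L) (P' : Finset α) (hP' : P' ⊆ P) (hP'card : P'.card = k₂) :
    IsTight 1 k₁ k₂ l P (insert e L) (I ∪ (P' ×ˢ {e})) := by
  obtain ⟨hI, hs, hc⟩ := htight
  have heI : ∀ x ∈ I, x.2 ≠ e := fun x hx hxe =>
    he (hxe ▸ (mem_product.1 (hI hx)).2)
  have hdisj : Disjoint I (P' ×ˢ {e}) := disjoint_left.2 fun x hx hx' =>
    heI x hx (mem_singleton.1 (mem_product.1 hx').2)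
  refine ⟨?_, ?_, ?_⟩
  · refine union_subset (hI.trans (product_subset_product_right (subset_insert e L))) ?_
    exact product_subset_product hP' (singleton_subset_iff.2 (mem_insert_self e L))
  · intro J hJ hne
    set A := J.filter (fun x => x.2 ≠ e)
    set B := J.filter (fun x => x.2 = e)
    have hAI : A ⊆ I := by
      intro x hx
      obtain ⟨hxJ, hxe⟩ := mem_filter.1 hx
      exact (mem_union.1 (hJ hxJ)).resolve_right fun h =>
        hxe (mem_singleton.1 (mem_product.1 h).2)
    have hBe : ∀ x ∈ B, x.2 = e := fun x hx => (mem_filter.1 hx).2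
    have hBP : B ⊆ P' ×ˢ {e} := by
      intro x hx
      obtain ⟨hxJ, hxe⟩ := mem_filter.1 hx
      exact (mem_union.1 (hJ hxJ)).resolve_left fun h => heI x h hxe
    have hBcard : B.card ≤ k₂ := by
      simpa [hP'card] using card_le_card hBP
    have hcard : B.card + A.card = J.card := card_filter_add_card_filter_not _
    rcases B.eq_empty_or_nonempty with hB0 | hB0
    · have hJA : J = A := by
        refine (filter_true_of_mem fun x hx hxe => ?_).symm
        exact notMem_empty x (hB0 ▸ mem_filter.2 ⟨hx, hxe⟩)
      exact hs J (hJA ▸ hAI) hne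
    rcases A.eq_empty_or_nonempty with hA0 | hA0
    · have hJe : ∀ x ∈ J, x.2 = e := fun x hx => by
        by_contra hxe
        exact notMem_empty x (hA0 ▸ mem_filter.2 ⟨hx, hxe⟩)
      have hline : 1 ≤ (J.image Prod.snd).card := (hne.image _).card_pos
      have hJ1 : 1 ≤ J.card := hne.card_pos
      rw [card_image_fst_of_snd_eq hJe]
      zify at hline hJ1 hk₁
      push_cast
      nlinarith [mul_nonneg (sub_nonneg.2 hk₁) (sub_nonneg.2 hJ1),
        mul_nonneg (Int.natCast_nonneg k₂) (sub_nonneg.2 hline)]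
    · have hsA := hs A hAI hA0
      have hpts : (A.image Prod.fst).card ≤ (J.image Prod.fst).card :=
        card_le_card (image_subset_image (filter_subset _ _))
      have hlines : (A.image Prod.snd).card + 1 ≤ (J.image Prod.snd).card := by
        have heA : e ∉ A.image Prod.snd := by
          intro h
          obtain ⟨x, hx, hxe⟩ := mem_image.1 h
          exact (mem_filter.1 hx).2 hxe
        rw [← card_insert_of_notMem heA]
        refine card_le_card (insert_subset ?_ (image_subset_image (filter_subset _ _)))
        obtain ⟨x, hx⟩ := hB0
        exact mem_image.2 ⟨x, (mem_filter.1 hx).1, hBe x hx⟩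
      zify at hpts hlines hBcard hcard
      push_cast at hsA ⊢
      nlinarith [mul_le_mul_of_nonneg_left hpts (Int.natCast_nonneg k₁),
        mul_le_mul_of_nonneg_left hlines (Int.natCast_nonneg k₂)]
  · rw [card_union_of_disjoint hdisj, card_insert_of_notMem he, card_product, card_singleton,
      hP'card]
    push_cast at hc ⊢
    linarith
end

section
/- Let k₁, k₂ ≥ 1 and l be natural numbers with l ≤ k₁ + k₂ − 1, and let P, L be finite sets with |P| ≥ k₂, |L| ≥ k₁ and |P||L| ≥ k₁|P| + k₂|L| − l. Then there exists a subset I ⊆ P×L such that the rank-2 incidence geometry (P,L,I) is (1,k₁,k₂,l)-tight. -/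
open Finset

variable {α β : Type*} [DecidableEq α] [DecidableEq β]

/-- The count of a grid minus a corner block, with `x` cells of the block put back, satisfies the
sparsity bound. Here `s + a` and `t + b` are the side lengths of the grid, `a` and `b` those of
the block. -/
lemma grid_count_le {k₁ k₂ l s a t b x : ℤ} (hl : l ≤ k₁ + k₂ - 1)
    (hs : s ≤ k₂) (ht : t ≤ k₁) (ha : 0 ≤ a) (hb : 0 ≤ b)
    (hsa : 1 ≤ s + a) (htb : 1 ≤ t + b) (hxab : x ≤ a * b) (hx : x ≤ k₁ * k₂ - l) :
    (s + a) * (t + b) - a * b + x ≤ k₁ * (s + a) + k₂ * (t + b) - l := by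
  by_cases h₁ : s + a ≤ k₂
  · by_cases h₂ : t + b ≤ k₁
    · nlinarith [mul_nonneg (sub_nonneg.2 h₁) (sub_nonneg.2 htb),
        mul_nonneg (sub_nonneg.2 h₂) (sub_nonneg.2 hsa),
        mul_nonneg (sub_nonneg.2 hsa) (sub_nonneg.2 htb)]
    · nlinarith [mul_nonneg (sub_nonneg.2 hs) (sub_nonneg.2 (not_le.1 h₂).le),
        mul_nonneg (sub_nonneg.2 ht) ha]
  · nlinarith [mul_nonneg (sub_nonneg.2 ht) (sub_nonneg.2 (not_le.1 h₁).le),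
      mul_nonneg (sub_nonneg.2 hs) hb]

/-- The part of the grid `A ×ˢ B` meeting `S` or `T` has the expected size. -/
lemma card_product_sdiff_product_sdiff (A S : Finset α) (B T : Finset β) :
    ((A ×ˢ B \ (A \ S) ×ˢ (B \ T)).card : ℤ) =
      A.card * B.card - (A \ S).card * (B \ T).card := by
  rw [cast_card_sdiff (product_subset_product sdiff_subset sdiff_subset)]
  simp only [card_product, Nat.cast_mul]

/-- Removing the block `(P \ S) ×ˢ (L \ T)` from the grid `P ×ˢ L`, where `|S| ≤ k₂` and
`|T| ≤ k₁`, and putting back at most `k₁ * k₂ - l` of its cells, leaves a sparse geometry. -/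
lemma isSparse_grid_sdiff_union {k₁ k₂ l : ℕ} (hl : (l : ℤ) ≤ (k₁ : ℤ) + (k₂ : ℤ) - 1)
    {P S : Finset α} {L T : Finset β} {X : Finset (α × β)}
    (hS : S.card ≤ k₂) (hT : T.card ≤ k₁) (hX : X ⊆ (P \ S) ×ˢ (L \ T))
    (hXc : (X.card : ℤ) ≤ k₁ * k₂ - l) :
    IsSparse 1 k₁ k₂ l (P ×ˢ L \ (P \ S) ×ˢ (L \ T) ∪ X) := by
  intro I hI hne
  set A := I.image Prod.fst
  set B := I.image Prod.snd
  have hIAB : I ⊆ A ×ˢ B := subset_product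
  have hx : I ∩ X ⊆ (A \ S) ×ˢ (B \ T) := by
    intro e he
    have h₁ := hIAB (mem_inter.1 he).1
    have h₂ := hX (mem_inter.1 he).2
    simp only [mem_product, mem_sdiff] at h₁ h₂ ⊢
    tauto
  have hy : I \ X ⊆ A ×ˢ B \ (A \ S) ×ˢ (B \ T) := by
    intro e he
    have h₁ := hIAB (mem_sdiff.1 he).1
    have h₂ := hI (mem_sdiff.1 he).1
    have h₃ := (mem_sdiff.1 he).2
    simp only [mem_product, mem_sdiff, mem_union] at h₁ h₂ ⊢
    tauto
  have hxc := card_le_card hx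
  have hxX : (I ∩ X).card ≤ X.card := card_le_card inter_subset_right
  have hyc := card_le_card hy
  have hsplit := card_inter_add_card_sdiff I X
  have hcard := card_product_sdiff_product_sdiff A S B T
  have hAS := card_inter_add_card_sdiff A S
  have hBT := card_inter_add_card_sdiff B T
  have hAS' : (A ∩ S).card ≤ S.card := card_le_card inter_subset_right
  have hBT' : (B ∩ T).card ≤ T.card := card_le_card inter_subset_right
  have hA1 : 1 ≤ A.card := (hne.image _).card_pos
  have hB1 : 1 ≤ B.card := (hne.image _).card_pos
  rw [card_product] at hxc
  have key := grid_count_le (k₁ := k₁) (k₂ := k₂) (l := l) (s := (A ∩ S).card)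
    (a := (A \ S).card) (t := (B ∩ T).card) (b := (B \ T).card) (x := (I ∩ X).card) hl
    (by lia) (by lia) (by positivity) (by positivity) (by lia) (by lia)
    (by exact_mod_cast hxc) (by lia)
  have hAS₂ : ((A ∩ S).card : ℤ) + (A \ S).card = A.card := by exact_mod_cast hAS
  have hBT₂ : ((B ∩ T).card : ℤ) + (B \ T).card = B.card := by exact_mod_cast hBT
  rw [hAS₂, hBT₂] at key
  push_cast
  lia

/-- If `|P| ≥ k₂`, `|L| ≥ k₁` and `|P| * |L| ≥ k₁ * |P| + k₂ * |L| - l`, then there is an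
incidence set `I ⊆ P ×ˢ L` making `(P, L, I)` a `(1, k₁, k₂, l)`-tight geometry. -/
theorem exists_tight_on (k₁ k₂ l : ℕ) (hk₁ : 1 ≤ k₁) (hk₂ : 1 ≤ k₂)
    (hl : (l : ℤ) ≤ (k₁ : ℤ) + (k₂ : ℤ) - 1)
    (P : Finset α) (L : Finset β) (hP : k₂ ≤ P.card) (hL : k₁ ≤ L.card)
    (hcard : (k₁ : ℤ) * P.card + (k₂ : ℤ) * L.card - l ≤ (P.card : ℤ) * L.card) :
    ∃ I : Finset (α × β), IsTight 1 k₁ k₂ l P L I := by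
  obtain ⟨S, hSP, hS⟩ := exists_subset_card_eq hP
  obtain ⟨T, hTL, hT⟩ := exists_subset_card_eq hL
  have hPS : ((P \ S).card : ℤ) = P.card - k₂ := by rw [cast_card_sdiff hSP, hS]
  have hLT : ((L \ T).card : ℤ) = L.card - k₁ := by rw [cast_card_sdiff hTL, hT]
  have hc : (l : ℤ) ≤ k₁ * k₂ := by
    have h₁ : (1 : ℤ) ≤ k₁ := by exact_mod_cast hk₁
    have h₂ : (1 : ℤ) ≤ k₂ := by exact_mod_cast hk₂
    nlinarith
  have hc' : l ≤ k₁ * k₂ := by exact_mod_cast hc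
  have hroom : k₁ * k₂ - l ≤ ((P \ S) ×ˢ (L \ T)).card := by
    rw [card_product]
    zify [hc']
    rw [hPS, hLT]
    linarith
  obtain ⟨X, hX, hXc⟩ := exists_subset_card_eq hroom
  have hXc' : (X.card : ℤ) = k₁ * k₂ - l := by rw [hXc]; push_cast [hc']; ring
  refine ⟨P ×ˢ L \ (P \ S) ×ˢ (L \ T) ∪ X, ?_,
    isSparse_grid_sdiff_union hl hS.le hT.le hX hXc'.le, ?_⟩
  · exact union_subset sdiff_subset
      (hX.trans (product_subset_product sdiff_subset sdiff_subset))
  · rw [card_union_of_disjoint (disjoint_sdiff_self_left.mono_right hX)]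
    push_cast
    rw [card_product_sdiff_product_sdiff, hXc', hPS, hLT]
    ring
end

section
/- Let k₁, k₂ ≥ 1 and l be natural numbers with l ≤ k₁ + k₂ − 1, and let P, L be finite sets. Suppose B₁, B₂ ⊆ P×L are such that both (P,L,B₁) and (P,L,B₂) are (1,k₁,k₂,l)-tight rank-2 incidence geometries. Then for every b ∈ B₂ \ B₁ there exists c ∈ B₁ \ B₂ such that (P, L, (B₁ \ {c}) ∪ {b}) is (1,k₁,k₂,l)-tight. -/
open Finset

variable {α β : Type*} [DecidableEq α] [DecidableEq β]

theorem card_image_union_add_card_image_inter_le {γ δ : Type*} [DecidableEq γ] [DecidableEq δ]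
    (g : γ → δ) (S T : Finset γ) :
    ((S ∪ T).image g).card + ((S ∩ T).image g).card ≤ (S.image g).card + (T.image g).card := by
  rw [image_union, ← card_union_add_card_inter (S.image g) (T.image g)]
  exact Nat.add_le_add_left (card_le_card (image_inter_subset g S T)) _

/-- The count `k₁ * |P(I)| + k₂ * |L(I)|` of the support of an incidence set `I`. -/
def supportCount (k₁ k₂ : ℕ) (I : Finset (α × β)) : ℕ :=
  k₁ * (I.image Prod.fst).card + k₂ * (I.image Prod.snd).card

theorem supportCount_mono (k₁ k₂ : ℕ) {S T : Finset (α × β)} (h : S ⊆ T) :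
    supportCount k₁ k₂ S ≤ supportCount k₁ k₂ T := by
  unfold supportCount
  gcongr

theorem supportCount_submodular (k₁ k₂ : ℕ) (S T : Finset (α × β)) :
    supportCount k₁ k₂ (S ∪ T) + supportCount k₁ k₂ (S ∩ T) ≤
      supportCount k₁ k₂ S + supportCount k₁ k₂ T := by
  have h₁ := Nat.mul_le_mul_left k₁ (card_image_union_add_card_image_inter_le Prod.fst S T)
  have h₂ := Nat.mul_le_mul_left k₂ (card_image_union_add_card_image_inter_le Prod.snd S T)
  unfold supportCount
  linarith

theorem supportCount_le_of_subset_product (k₁ k₂ : ℕ) {P : Finset α} {L : Finset β}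
    {I : Finset (α × β)} (h : I ⊆ P ×ˢ L) :
    supportCount k₁ k₂ I ≤ k₁ * P.card + k₂ * L.card := by
  have h₁ : I.image Prod.fst ⊆ P := image_subset_iff.2 fun x hx => (mem_product.1 (h hx)).1
  have h₂ : I.image Prod.snd ⊆ L := image_subset_iff.2 fun x hx => (mem_product.1 (h hx)).2
  unfold supportCount
  gcongr

theorem isSparse_one_iff {k₁ k₂ l : ℕ} {I : Finset (α × β)} :
    IsSparse 1 k₁ k₂ l I ↔
      ∀ T ⊆ I, T.Nonempty → T.card + l ≤ supportCount k₁ k₂ T := by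
  refine forall_congr' fun T => imp_congr_right fun _ => imp_congr_right fun _ => ?_
  unfold supportCount
  zify
  constructor <;> intro h <;> linarith

/-- In a sparse incidence set, the subsets that become overcounted on adding `b` are closed
under intersection. -/
theorem IsSparse.supportCount_insert_inter_le {k₁ k₂ l : ℕ} {I S T : Finset (α × β)}
    {b : α × β} (hI : IsSparse 1 k₁ k₂ l I) (hS : S ⊆ I) (hT : T ⊆ I) (hne : S.Nonempty)
    (hSb : supportCount k₁ k₂ (insert b S) ≤ S.card + l)
    (hTb : supportCount k₁ k₂ (insert b T) ≤ T.card + l) :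
    supportCount k₁ k₂ (insert b (S ∩ T)) ≤ (S ∩ T).card + l := by
  have hsub := supportCount_submodular k₁ k₂ (insert b S) (insert b T)
  rw [← insert_union_distrib, ← insert_inter_distrib] at hsub
  have hmono := supportCount_mono k₁ k₂ (subset_insert b (S ∪ T))
  have hunion := isSparse_one_iff.1 hI (S ∪ T) (union_subset hS hT) (hne.mono subset_union_left)
  have hcard := card_union_add_card_inter S T
  omega

/-- Basis exchange for `(1, k₁, k₂, l)`-tight geometries on a fixed point set and line set:
for tight `B₁, B₂` and `b ∈ B₂ \ B₁` there is `c ∈ B₁ \ B₂` with `(B₁ \ {c}) ∪ {b}` tight. -/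
theorem tight_exchange (k₁ k₂ l : ℕ) (hk₁ : 1 ≤ k₁) (hk₂ : 1 ≤ k₂)
    (hl : (l : ℤ) ≤ (k₁ : ℤ) + (k₂ : ℤ) - 1)
    (P : Finset α) (L : Finset β) (B₁ B₂ : Finset (α × β))
    (h₁ : IsTight 1 k₁ k₂ l P L B₁) (h₂ : IsTight 1 k₁ k₂ l P L B₂) :
    ∀ b ∈ B₂ \ B₁, ∃ c ∈ B₁ \ B₂,
      IsTight 1 k₁ k₂ l P L (insert b (B₁.erase c)) := by
  intro b hb
  obtain ⟨hb₂, hb₁⟩ := mem_sdiff.1 hb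
  obtain ⟨hB₁, hs₁, hc₁⟩ := h₁
  obtain ⟨hB₂, hs₂, -⟩ := h₂
  have hinsert : insert b B₁ ⊆ P ×ˢ L := insert_subset (hB₂ hb₂) hB₁
  let F := B₁.powerset.filter fun T => supportCount k₁ k₂ (insert b T) ≤ T.card + l
  have hF : F.Nonempty := by
    refine ⟨B₁, mem_filter.2 ⟨mem_powerset_self _, ?_⟩⟩
    have := supportCount_le_of_subset_product k₁ k₂ hinsert
    push_cast at hc₁
    zify at this ⊢
    linarith
  obtain ⟨C, hCF, hmin⟩ := exists_min_image F card hF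
  obtain ⟨hC, hCb⟩ := mem_filter.1 hCF
  rw [mem_powerset] at hC
  obtain ⟨c, hcC, hc₂⟩ : ∃ c ∈ C, c ∉ B₂ := by
    by_contra! hCB₂
    have h := isSparse_one_iff.1 hs₂ (insert b C) (insert_subset hb₂ hCB₂) (insert_nonempty _ _)
    rw [card_insert_of_notMem fun h => hb₁ (hC h)] at h
    omega
  refine ⟨c, mem_sdiff.2 ⟨hC hcC, hc₂⟩, ?_, ?_, ?_⟩
  · exact (insert_subset_insert b (erase_subset c B₁)).trans hinsert
  · refine isSparse_one_iff.2 fun T hT hne => ?_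
    by_cases hbT : b ∈ T
    · by_contra! hlt
      have hsub : T.erase b ⊆ B₁.erase c := subset_insert_iff.1 hT
      have hTB : T.erase b ⊆ B₁ := hsub.trans (erase_subset _ _)
      have hTb : supportCount k₁ k₂ (insert b (T.erase b)) ≤ (T.erase b).card + l := by
        have := card_erase_add_one hbT
        rw [insert_erase hbT]
        omega
      have hle := hmin (C ∩ T.erase b) <| mem_filter.2
        ⟨mem_powerset.2 (inter_subset_left.trans hC),
          hs₁.supportCount_insert_inter_le hC hTB ⟨c, hcC⟩ hCb hTb⟩
      have heq := eq_of_subset_of_card_le inter_subset_left hle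
      rw [← heq] at hcC
      exact notMem_erase c B₁ (hsub (mem_inter.1 hcC).2)
    · exact isSparse_one_iff.1 hs₁ T
        (((subset_insert_iff_of_notMem hbT).1 hT).trans (erase_subset _ _)) hne
  · rw [card_insert_of_notMem fun h => hb₁ (mem_of_mem_erase h), card_erase_add_one (hC hcC)]
    exact hc₁
end

section
/- Let V be a 4-element set, L the set of all 2-element subsets of V (the edges of K₄), and E₀ = {(v,e) ∈ V × L : v ∈ e}. There exist subsets B₁, B₂ ⊆ E₀ and an element b ∈ B₂ \ B₁ such that the geometries (P(B₁), L(B₁), B₁) and (P(B₂), L(B₂), B₂) are both (2,2,3,3)-tight with |P(Bᵢ)| = 4 and |L(Bᵢ)| = 5, but for every c ∈ B₁ \ B₂ the set B' = (B₁ \ {c}) ∪ {b} is such that (P(B'), L(B'), B') is not (2,2,3,3)-tight. In particular, the (2,2,3,3)-tight geometries with 4 points and 5 lines inside E₀ do not satisfy the matroid basis exchange axiom. -/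
open Finset

variable {α β : Type*} [DecidableEq α] [DecidableEq β]

/-- A set of incidences `B` is `(lam, k₁, k₂, l)`-tight on its support if it is sparse and
`lam * |B| = k₁ * |P(B)| + k₂ * |L(B)| - l`. -/
def TightOnSupport (lam k₁ k₂ l : ℕ) (B : Finset (α × β)) : Prop :=
  IsSparse lam k₁ k₂ l B ∧
    (lam : ℤ) * B.card =
      (k₁ : ℤ) * (B.image Prod.fst).card + (k₂ : ℤ) * (B.image Prod.snd).card - l

/-- The incidences of `K₄`: pairs `(v, e)` where `e` is a 2-element subset of the
4-element vertex set and `v ∈ e`. -/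
def E₀ : Finset (Fin 4 × Finset (Fin 4)) :=
  Finset.univ.filter fun x => x.2.card = 2 ∧ x.1 ∈ x.2

/-- The incidences of `K₄` with the edge `e` deleted. -/
def incidencesAvoiding (e : Finset (Fin 4)) : Finset (Fin 4 × Finset (Fin 4)) :=
  E₀.filter fun x => x.2 ≠ e

theorem card_fiber_le_card_inter {I : Finset (α × Finset α)} (hI : ∀ x ∈ I, x.1 ∈ x.2)
    (e : Finset α) : (I.filter fun x => x.2 = e).card ≤ (e ∩ I.image Prod.fst).card := by
  refine card_le_card_of_injOn Prod.fst ?_ ?_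
  · intro x hx
    obtain ⟨hxI, rfl⟩ := mem_filter.1 hx
    exact mem_inter.2 ⟨hI x hxI, mem_image_of_mem _ hxI⟩
  · intro x hx y hy hxy
    exact Prod.ext hxy ((mem_filter.1 hx).2.trans (mem_filter.1 hy).2.symm)

/-- Incidences of a graph satisfying the Laman count `|E(P)| ≤ 2|P| - 3` on every set `P` of at
least two vertices form a `(2, 2, 3, 3)`-sparse geometry. -/
theorem isSparse_of_laman {edges : Finset (Finset α)} (hcard : ∀ e ∈ edges, e.card = 2)
    (hlaman : ∀ P : Finset α, 2 ≤ P.card → (edges.filter fun e => e ⊆ P).card + 3 ≤ 2 * P.card)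
    {B : Finset (α × Finset α)} (hB : ∀ x ∈ B, x.1 ∈ x.2 ∧ x.2 ∈ edges) :
    IsSparse 2 2 3 3 B := by
  intro I hIB hI
  have hfiber := card_fiber_le_card_inter fun x hx => (hB x (hIB hx)).1
  have hlines : I.image Prod.snd ⊆ edges :=
    image_subset_iff.2 fun x hx => (hB x (hIB hx)).2
  have hP : 0 < (I.image Prod.fst).card := (hI.image _).card_pos
  have hL : 0 < (I.image Prod.snd).card := (hI.image _).card_pos
  have hsum := card_eq_sum_card_image Prod.snd I
  set P := I.image Prod.fst
  set L := I.image Prod.snd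
  rcases Nat.lt_or_ge P.card 2 with hP2 | hP2
  · have hle : I.card ≤ L.card := by
      rw [hsum, card_eq_sum_ones]
      refine sum_le_sum fun e _ => (hfiber e).trans ?_
      exact (card_le_card inter_subset_right).trans (by omega)
    push_cast
    omega
  · have hle : 2 * I.card ≤ 3 * L.card + (L.filter fun e => e ⊆ P).card := by
      rw [hsum, mul_sum, card_filter, mul_comm 3, ← smul_eq_mul L.card, ← sum_const,
        ← sum_add_distrib]
      refine sum_le_sum fun e he => ?_
      have he2 := hcard e (hlines he)
      have hfe := hfiber e
      split_ifs with heP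
      · have := card_le_card (inter_subset_left : e ∩ P ⊆ e)
        omega
      · have : (e ∩ P).card < e.card := card_lt_card
          ⟨inter_subset_left, fun h => heP (h.trans inter_subset_right)⟩
        omega
    have := hlaman P hP2
    have := card_le_card (filter_subset_filter (fun e => e ⊆ P) hlines)
    push_cast
    omega

theorem isSparse_incidencesAvoiding {e : Finset (Fin 4)} (he : e.card = 2) :
    IsSparse 2 2 3 3 (incidencesAvoiding e) := by
  refine isSparse_of_laman (edges := (powersetCard 2 univ).erase e) ?_ ?_ ?_
  · exact fun f hf => (mem_powersetCard.1 (mem_of_mem_erase hf)).2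
  · revert e
    decide +kernel
  · intro x hx
    simp only [incidencesAvoiding, E₀, mem_filter, mem_univ, true_and] at hx
    simp [hx]

/-- The `(2, 2, 3, 3)`-tight geometries with 4 points and 5 lines inside the incidences of
`K₄` fail the matroid basis exchange axiom. -/
theorem no_basis_exchange :
    ∃ B₁ B₂ : Finset (Fin 4 × Finset (Fin 4)), B₁ ⊆ E₀ ∧ B₂ ⊆ E₀ ∧
      ∃ b ∈ B₂ \ B₁,
        TightOnSupport 2 2 3 3 B₁ ∧ TightOnSupport 2 2 3 3 B₂ ∧
        (B₁.image Prod.fst).card = 4 ∧ (B₁.image Prod.snd).card = 5 ∧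
        (B₂.image Prod.fst).card = 4 ∧ (B₂.image Prod.snd).card = 5 ∧
        ∀ c ∈ B₁ \ B₂, ¬ TightOnSupport 2 2 3 3 (insert b (B₁.erase c)) := by
  refine ⟨incidencesAvoiding {0, 1}, incidencesAvoiding {2, 3}, filter_subset _ _,
    filter_subset _ _, (0, {0, 1}), by decide +kernel,
    ⟨isSparse_incidencesAvoiding rfl, by decide +kernel⟩,
    ⟨isSparse_incidencesAvoiding rfl, by decide +kernel⟩,
    by decide +kernel, by decide +kernel, by decide +kernel, by decide +kernel, ?_⟩
  have not_balanced : ∀ c ∈ incidencesAvoiding {0, 1} \ incidencesAvoiding {2, 3},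
      let B := insert (0, {0, 1}) ((incidencesAvoiding {0, 1}).erase c)
      ¬ ((2 : ℕ) : ℤ) * B.card = ((2 : ℕ) : ℤ) * (B.image Prod.fst).card +
        ((3 : ℕ) : ℤ) * (B.image Prod.snd).card - (3 : ℕ) := by
    decide +kernel
  exact fun c hc h => not_balanced c hc h.2
end
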